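/- arXiv:1908.08725 — 2 statements merged into one kernel-verified Lean document; each statement's English description precedes it below -/
import Mathlib

section
/- Let m_{i,j} : ℝ → ℝ and α_i : ℝ → ℝ (i, j ∈ ℕ) be twice differentiable functions of t satisfying m_{i,j} = m_{j,i}, m_{i,j}′ = m_{i+1,j} + m_{i,j+1}, α_i′ = α_{i+1}, and the rank one shift condition m_{i+1,j} + m_{i,j+1} = α_i·α_j for all i, j. Define τ_0 = 1, τ_n = det((m_{i,j})_{i,j=0}^{n−1}), and σ̃_n = det(M⁽ⁿ⁾), where M⁽ⁿ⁾ is the (n+1)×(n+1) matrix whose first n columns are (m_{i,j})_{i=0,…,n; j=0,…,n−1} and whose last column is (α_i)_{i=0,…,n}. Then for every n ≥ 0 and all t: τ_{n+1}″·τ_{n+1} − (τ_{n+1}′)² = 2·σ̃_n·σ̃_{n+1} (equivalently, in Hirota form, D_{t₁}² τ_{n+1} · τ_{n+1} = 4 σ̃_n·σ̃_{n+1}). -/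
/-- `τ_n(t) = det((m_{i,j}(t))_{i,j=0}^{n−1})`; in particular `τ_0 = 1`. -/
noncomputable def tauDet (m : ℕ → ℕ → ℝ → ℝ) (n : ℕ) : ℝ → ℝ :=
  fun t => (Matrix.of fun i j : Fin n => m i j t).det

/-- `σ̃_n(t)`: the bordered determinant whose first `n` columns are `(m_{i,j})` for
`i = 0,…,n`, `j = 0,…,n−1`, and whose last column is `(α_0,…,α_n)`. -/
noncomputable def sigmaDet (m : ℕ → ℕ → ℝ → ℝ) (α : ℕ → ℝ → ℝ) (n : ℕ) : ℝ → ℝ :=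
  fun t => (Matrix.of fun i j : Fin (n + 1) =>
    if (j : ℕ) = n then α (i : ℕ) t else m (i : ℕ) (j : ℕ) t).det

namespace Matrix

/-- Column form of Jacobi's formula. -/
theorem hasDerivAt_det {ι : Type*} [Fintype ι] [DecidableEq ι] {A : ℝ → Matrix ι ι ℝ}
    {A' : Matrix ι ι ℝ} {t : ℝ} (h : ∀ i j, HasDerivAt (fun s => A s i j) (A' i j) t) :
    HasDerivAt (fun s => (A s).det)
      (∑ k, ((A t).updateCol k fun i => A' i k).det) t := by
  simp only [det_apply']
  rw [Finset.sum_comm]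
  refine HasDerivAt.fun_sum fun σ _ => ?_
  rw [← Finset.mul_sum]
  refine HasDerivAt.const_mul _ ?_
  convert! HasDerivAt.fun_finsetProd (u := Finset.univ) fun i _ => h (σ i) i using 1
  refine Finset.sum_congr rfl fun k _ => ?_
  rw [← Finset.prod_erase_mul _ _ (Finset.mem_univ k), updateCol_self, smul_eq_mul]
  congr 1
  exact Finset.prod_congr rfl fun j hj => updateCol_ne (Finset.ne_of_mem_erase hj)

/-- Derivative of the determinant when the matrix moves in the rank one direction `u uᵀ`. -/
theorem hasDerivAt_det_of_rank_one {ι : Type*} [Fintype ι] [DecidableEq ι]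
    {A : ℝ → Matrix ι ι ℝ} {u : ι → ℝ} {t : ℝ}
    (h : ∀ i j, HasDerivAt (fun s => A s i j) (u i * u j) t) :
    HasDerivAt (fun s => (A s).det) (u ⬝ᵥ cramer (A t) u) t := by
  refine (hasDerivAt_det (A' := of fun i j => u i * u j) h).congr_deriv ?_
  refine Finset.sum_congr rfl fun k _ => ?_
  rw [cramer_apply, ← det_updateCol_smul]
  congr 2
  ext i
  simp [mul_comm]

/-- When the matrix moves in the rank one direction `u uᵀ`, where `u` is also the right-hand side
of Cramer's rule, only the motion of the right-hand side contributes to the derivative. -/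
theorem hasDerivAt_cramer_of_rank_one {ι : Type*} [Fintype ι] [DecidableEq ι]
    {A : ℝ → Matrix ι ι ℝ} {u : ℝ → ι → ℝ} {u' : ι → ℝ} {t : ℝ}
    (hA : ∀ i j, HasDerivAt (fun s => A s i j) (u t i * u t j) t)
    (hu : ∀ i, HasDerivAt (fun s => u s i) (u' i) t) (j : ι) :
    HasDerivAt (fun s => cramer (A s) (u s) j) (cramer (A t) u' j) t := by
  simp only [cramer_apply]
  have h (i k : ι) : HasDerivAt (fun s => (A s).updateCol j (u s) i k)
      ((of fun i k => u t i * u t k : Matrix ι ι ℝ).updateCol j u' i k) t := by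
    rcases eq_or_ne k j with rfl | hk
    · simpa using hu i
    · simpa [updateCol_ne hk] using hA i k
  refine (hasDerivAt_det h).congr_deriv ?_
  rw [Finset.sum_eq_single j]
  · simp
  · intro k _ hk
    have hcol : (fun i => (of fun i k => u t i * u t k : Matrix ι ι ℝ).updateCol j u' i k)
        = u t k • u t := by
      ext i
      simp [updateCol_ne hk, mul_comm]
    rw [hcol, det_updateCol_smul, det_zero_of_column_eq hk, mul_zero]
    intro i
    simp [updateCol_ne hk.symm]
  · simp

theorem cramer_dotProduct_comm_of_isSymm {ι R : Type*} [Fintype ι] [DecidableEq ι] [CommRing R]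
    {A : Matrix ι ι R} (hA : A.IsSymm) (u v : ι → R) :
    u ⬝ᵥ cramer A v = v ⬝ᵥ cramer A u := by
  rw [cramer_eq_adjugate_mulVec, cramer_eq_adjugate_mulVec, dotProduct_mulVec, dotProduct_comm,
    ← mulVec_transpose, adjugate_transpose, hA.eq]

theorem det_of_last_row_eq_single {R : Type*} [CommRing R] {n : ℕ}
    (B : Matrix (Fin (n + 1)) (Fin (n + 1)) R)
    (h : ∀ j, B (Fin.last n) j = if j = Fin.last n then 1 else 0) :
    B.det = (B.submatrix Fin.castSucc Fin.castSucc).det := by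
  rw [det_succ_row B (Fin.last n), Fin.sum_univ_castSucc]
  simp [h, Fin.castSucc_ne_last, Fin.succAbove_last]

/-- Determinant of a matrix bordered by a row and a column. -/
theorem det_eq_sub_sum_mul_cramer {R : Type*} [CommRing R] {n : ℕ}
    (B : Matrix (Fin (n + 1)) (Fin (n + 1)) R) :
    B.det = B (Fin.last n) (Fin.last n) * (B.submatrix Fin.castSucc Fin.castSucc).det -
      ∑ j, B (Fin.last n) j.castSucc *
        cramer (B.submatrix Fin.castSucc Fin.castSucc) (fun i => B i.castSucc (Fin.last n)) j := by
  rw [det_eq_sum_mul_adjugate_row B (Fin.last n), Fin.sum_univ_castSucc, add_comm, sub_eq_add_neg,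
    ← Finset.sum_neg_distrib]
  congr 1
  · rw [adjugate_apply, det_of_last_row_eq_single]
    · congr 2
      ext i j
      simp [Fin.castSucc_ne_last]
    · intro j
      simp [Pi.single_apply]
  · refine Finset.sum_congr rfl fun j _ => ?_
    rw [← mul_neg, adjugate_apply, cramer_apply]
    have hne : j.castSucc ≠ Fin.last n := Fin.castSucc_ne_last j
    set C := B.updateRow (Fin.last n) (Pi.single j.castSucc 1) with hC
    have hperm := det_permute' (Equiv.swap j.castSucc (Fin.last n)) C
    rw [Equiv.Perm.sign_swap hne, det_of_last_row_eq_single] at hperm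
    · rw [show C.det = -_ from neg_eq_iff_eq_neg.mp (by simpa using hperm.symm)]
      congr 3
      ext i k
      rcases eq_or_ne k j with rfl | hk
      · simp [hC, Fin.castSucc_ne_last]
      · simp [hC, Fin.castSucc_ne_last, updateCol_ne hk,
          Equiv.swap_apply_of_ne_of_ne (Fin.castSucc_injective n |>.ne hk)
            (Fin.castSucc_ne_last k)]
    · intro k
      simp [hC, Pi.single_apply, Equiv.swap_apply_eq_iff]

end Matrix

open Matrix

section BilinearIdentity

variable {R : Type*} [CommRing R] {μ : ℕ → ℕ → R} {a : ℕ → R}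

theorem det_bordered_eq_cramer_last (μ : ℕ → ℕ → R) (a : ℕ → R) (n : ℕ) :
    (of fun i j : Fin (n + 1) => if (j : ℕ) = n then a i else μ i j).det =
      cramer (of fun i j : Fin (n + 1) => μ i j) (fun i => a i) (Fin.last n) := by
  rw [cramer_apply]
  congr 1
  ext i j
  simp [updateCol_apply, Fin.ext_iff]

theorem sum_shift_mul_cramer_castSucc (μ : ℕ → ℕ → R) (a : ℕ → R) (n : ℕ) (i : Fin n) :
    ∑ j : Fin (n + 1), μ (i + 1) j *
        cramer (of fun i j : Fin (n + 1) => μ i j) (fun i => a i) j =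
      (of fun i j : Fin (n + 1) => μ i j).det * a (i + 1) := by
  simpa [mulVec, dotProduct] using
    congrFun (mulVec_cramer (of fun i j : Fin (n + 1) => μ i j) fun i => a i) i.succ

theorem sum_shift_mul_cramer_last (μ : ℕ → ℕ → R) (a : ℕ → R) (n : ℕ) :
    ∑ j : Fin (n + 1), μ (n + 1) j *
        cramer (of fun i j : Fin (n + 1) => μ i j) (fun i => a i) j =
      (of fun i j : Fin (n + 1) => μ i j).det * a (n + 1) -
        (of fun i j : Fin (n + 2) => if (j : ℕ) = n + 1 then a i else μ i j).det := by
  have hsub : (of fun i j : Fin (n + 2) => if (j : ℕ) = n + 1 then a i else μ i j).submatrix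
      Fin.castSucc Fin.castSucc = of fun i j : Fin (n + 1) => μ i j := by
    ext i j
    simp [j.isLt.ne]
  rw [det_eq_sub_sum_mul_cramer
    (of fun i j : Fin (n + 2) => if (j : ℕ) = n + 1 then a i else μ i j), hsub]
  simp [fun j : Fin (n + 1) => j.isLt.ne]
  ring

theorem two_mul_sum_shift_mul_mul {N : ℕ} (hsym : ∀ i j, μ i j = μ j i)
    (hrank : ∀ i j, μ (i + 1) j + μ i (j + 1) = a i * a j) (w : Fin N → R) :
    2 * ∑ i : Fin N, w i * ∑ j : Fin N, μ (i + 1) j * w j = (∑ i : Fin N, a i * w i) ^ 2 := by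
  rw [two_mul]
  simp only [Finset.mul_sum]
  nth_rewrite 2 [Finset.sum_comm]
  rw [sq, Finset.sum_mul_sum, ← Finset.sum_add_distrib]
  refine Finset.sum_congr rfl fun i _ => ?_
  rw [← Finset.sum_add_distrib]
  refine Finset.sum_congr rfl fun j _ => ?_
  rw [hsym (j + 1) i]
  linear_combination w i * w j * hrank i j

/-- Bilinear identity behind the C-Toda equation, valid over any commutative ring. -/
theorem det_mul_cramer_sub_sq (hsym : ∀ i j, μ i j = μ j i)
    (hrank : ∀ i j, μ (i + 1) j + μ i (j + 1) = a i * a j) (n : ℕ) :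
    2 * ((fun i : Fin (n + 1) => a (i + 1)) ⬝ᵥ
            cramer (of fun i j : Fin (n + 1) => μ i j) (fun i => a i)) *
          (of fun i j : Fin (n + 1) => μ i j).det -
        ((fun i : Fin (n + 1) => a i) ⬝ᵥ
            cramer (of fun i j : Fin (n + 1) => μ i j) (fun i => a i)) ^ 2 =
      2 * (of fun i j : Fin (n + 1) => if (j : ℕ) = n then a i else μ i j).det *
        (of fun i j : Fin (n + 2) => if (j : ℕ) = n + 1 then a i else μ i j).det := by
  have hcast := sum_shift_mul_cramer_castSucc μ a n
  have hlast := sum_shift_mul_cramer_last μ a n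
  rw [det_bordered_eq_cramer_last μ a n]
  generalize cramer (of fun i j : Fin (n + 1) => μ i j) (fun i => a i) = w at *
  simp only [dotProduct]
  rw [← two_mul_sum_shift_mul_mul hsym hrank w, Fin.sum_univ_castSucc,
    Fin.sum_univ_castSucc (f := fun i : Fin (n + 1) => w i * _)]
  simp only [Fin.val_castSucc, Fin.val_last, hcast, hlast]
  rw [show ∑ i : Fin n, w i.castSucc * ((of fun i j : Fin (n + 1) => μ i j).det * a (i + 1)) =
      (of fun i j : Fin (n + 1) => μ i j).det * ∑ i : Fin n, a (i + 1) * w i.castSucc by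
    rw [Finset.mul_sum]
    exact Finset.sum_congr rfl fun i _ => by ring]
  ring

end BilinearIdentity

/-- second equation of the C-Toda lattice: for symmetric moments evolving by
`∂ₜ m_{i,j} = m_{i+1,j} + m_{i,j+1}` with the rank one shift condition
`m_{i+1,j} + m_{i,j+1} = α_i α_j`, `∂ₜ α_i = α_{i+1}`, one has
`τ_{n+1}″·τ_{n+1} − (τ_{n+1}′)² = 2·σ̃_n·σ̃_{n+1}`
(Hirota form: `D² τ_{n+1}·τ_{n+1} = 4 σ̃_n·σ̃_{n+1}`). -/
theorem stmt17 (m : ℕ → ℕ → ℝ → ℝ) (α : ℕ → ℝ → ℝ)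
    (hsym : ∀ i j t, m i j t = m j i t)
    (hm2 : ∀ i j, ContDiff ℝ 2 (m i j))
    (hα2 : ∀ i, ContDiff ℝ 2 (α i))
    (hmder : ∀ i j t, deriv (m i j) t = m (i + 1) j t + m i (j + 1) t)
    (hαder : ∀ i t, deriv (α i) t = α (i + 1) t)
    (hrank1 : ∀ i j t, m (i + 1) j t + m i (j + 1) t = α i t * α j t) :
    ∀ n : ℕ, ∀ t : ℝ,
      deriv (deriv (tauDet m (n + 1))) t * tauDet m (n + 1) t -
          (deriv (tauDet m (n + 1)) t) ^ 2 =
        2 * sigmaDet m α n t * sigmaDet m α (n + 1) t := by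
  intro n t
  set A : ℝ → Matrix (Fin (n + 1)) (Fin (n + 1)) ℝ := fun s => of fun i j => m i j s
  have hdm (i j : ℕ) (s : ℝ) : HasDerivAt (m i j) (α i s * α j s) s := by
    rw [← hrank1, ← hmder]
    exact ((hm2 i j).differentiable two_ne_zero s).hasDerivAt
  have hdα (i : ℕ) (s : ℝ) : HasDerivAt (α i) (α (i + 1) s) s := by
    rw [← hαder]
    exact ((hα2 i).differentiable two_ne_zero s).hasDerivAt
  have hτ (s : ℝ) : HasDerivAt (tauDet m (n + 1))
      ((fun i : Fin (n + 1) => α i s) ⬝ᵥ cramer (A s) fun i => α i s) s :=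
    hasDerivAt_det_of_rank_one (A := A) fun i j => hdm i j s
  have hτ' : HasDerivAt (deriv (tauDet m (n + 1)))
      (2 * ((fun i : Fin (n + 1) => α (i + 1) t) ⬝ᵥ cramer (A t) fun i => α i t)) t := by
    rw [funext fun s => (hτ s).deriv]
    refine (HasDerivAt.fun_sum fun (i : Fin (n + 1)) _ => (hdα i t).mul
      (hasDerivAt_cramer_of_rank_one (A := A) (u := fun s i => α i s) (fun i j => hdm i j t)
        (fun j : Fin (n + 1) => hdα j t) i)).congr_deriv ?_
    rw [Finset.sum_add_distrib, two_mul]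
    exact congrArg _ (cramer_dotProduct_comm_of_isSymm (A := A t)
      (IsSymm.ext fun i j => hsym j i t) (fun i => α i t) fun i => α (i + 1) t)
  rw [hτ'.deriv, (hτ t).deriv]
  exact det_mul_cramer_sub_sq (μ := fun i j => m i j t) (a := fun i => α i t)
    (fun i j => hsym i j t) (fun i j => hrank1 i j t) n
end

section
/- Let τ̂_n : ℝ → ℝ (n ∈ ℕ) be differentiable and nowhere vanishing, and let P̃_n : ℝ × ℝ → ℝ (n ∈ ℕ), (x,t) ↦ P̃_n(x,t), be differentiable in t. Set u_n = τ̂_{n+1}τ̂_{n−1}/τ̂_n² (n ≥ 1) and v_n = τ̂_n′/τ̂_n (n ∈ ℕ). Assume that for every n ≥ 1, all x and all t: (H1) x·P̃_n + ∂_t P̃_n = P̃_{n+1} + (v_{n+1} − v_n)·P̃_n − u_{n+1}u_n·P̃_{n−1}; and (H2) ∂_t P̃_n = (τ̂_{n+1}/τ̂_n)·Σ_{i=1}^{n} (−1)^{n−i}·(v_{i+1} − v_{i−1})·(τ̂_{i−1}/τ̂_i)·P̃_{i−1}. Then the four-term recurrence relation holds: for every n ≥ 2, all x and all t, x·(P̃_n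 + u_n·P̃_{n−1}) = P̃_{n+1} + (v_{n+1} − v_n + u_n)·P̃_n − u_n·(v_{n+1} − v_n + u_{n+1})·P̃_{n−1} − u_n²·u_{n−1}·P̃_{n−2}. -/
/-- `u_n = τ̂_{n+1}·τ̂_{n−1}/τ̂_n²`. -/
noncomputable def uCoef (τ : ℕ → ℝ → ℝ) (n : ℕ) (t : ℝ) : ℝ :=
  τ (n + 1) t * τ (n - 1) t / (τ n t) ^ 2

/-- `v_n = τ̂_n′/τ̂_n = ∂ₜ log τ̂_n`. -/
noncomputable def vCoef (τ : ℕ → ℝ → ℝ) (n : ℕ) (t : ℝ) : ℝ :=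
  deriv (τ n) t / τ n t

/-- Consecutive instances of the derivative formula combine so that all but the top term of the
alternating sum cancel. -/
theorem deriv_add_uCoef_mul_deriv (τ : ℕ → ℝ → ℝ) (P : ℕ → ℝ → ℝ → ℝ)
    (hτne : ∀ n t, τ n t ≠ 0)
    (hP : ∀ n : ℕ, 1 ≤ n → ∀ x t : ℝ,
      deriv (fun s => P n x s) t =
        (τ (n + 1) t / τ n t) *
          ∑ i ∈ Finset.Icc 1 n, (-1 : ℝ) ^ (n - i) *
            (vCoef τ (i + 1) t - vCoef τ (i - 1) t) * (τ (i - 1) t / τ i t) *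
              P (i - 1) x t)
    (n : ℕ) (hn : 1 ≤ n) (x t : ℝ) :
    deriv (fun s => P (n + 1) x s) t + uCoef τ (n + 1) t * deriv (fun s => P n x s) t =
      uCoef τ (n + 1) t * (vCoef τ (n + 2) t - vCoef τ n t) * P n x t := by
  have hsum : ∑ i ∈ Finset.Icc 1 n, (-1 : ℝ) ^ (n + 1 - i) *
        (vCoef τ (i + 1) t - vCoef τ (i - 1) t) * (τ (i - 1) t / τ i t) * P (i - 1) x t =
      -∑ i ∈ Finset.Icc 1 n, (-1 : ℝ) ^ (n - i) *
        (vCoef τ (i + 1) t - vCoef τ (i - 1) t) * (τ (i - 1) t / τ i t) * P (i - 1) x t := by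
    rw [← Finset.sum_neg_distrib]
    refine Finset.sum_congr rfl fun i hi => ?_
    rw [Nat.succ_sub (Finset.mem_Icc.mp hi).2, pow_succ]
    ring
  rw [hP (n + 1) (by omega), hP n hn, Finset.sum_Icc_succ_top (by omega), hsum]
  have h₀ := hτne n t
  have h₁ := hτne (n + 1) t
  simp only [uCoef, Nat.add_sub_cancel, Nat.sub_self, pow_zero]
  field_simp
  ring

/-- given tau functions `τ̂_n` and polynomials `P̃_n(x,t)` satisfying the
recurrence (H1) `x·P̃_n + ∂ₜP̃_n = P̃_{n+1} + (v_{n+1} − v_n)·P̃_n − u_{n+1}u_n·P̃_{n−1}`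
and the derivative formula (H2)
`∂ₜP̃_n = (τ̂_{n+1}/τ̂_n)·Σ_{i=1}^n (−1)^{n−i}(v_{i+1} − v_{i−1})(τ̂_{i−1}/τ̂_i)·P̃_{i−1}`,
the four-term recurrence holds for all `n ≥ 2`:
`x·(P̃_n + u_n·P̃_{n−1}) = P̃_{n+1} + (v_{n+1} − v_n + u_n)·P̃_n
  − u_n·(v_{n+1} − v_n + u_{n+1})·P̃_{n−1} − u_n²·u_{n−1}·P̃_{n−2}`. -/
theorem stmt18 (τ : ℕ → ℝ → ℝ) (P : ℕ → ℝ → ℝ → ℝ)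
    (hτdiff : ∀ n, Differentiable ℝ (τ n))
    (hτne : ∀ n t, τ n t ≠ 0)
    (hPdiff : ∀ n x, Differentiable ℝ (fun t => P n x t))
    (H1 : ∀ n : ℕ, 1 ≤ n → ∀ x t : ℝ,
      x * P n x t + deriv (fun s => P n x s) t =
        P (n + 1) x t + (vCoef τ (n + 1) t - vCoef τ n t) * P n x t -
          uCoef τ (n + 1) t * uCoef τ n t * P (n - 1) x t)
    (H2 : ∀ n : ℕ, 1 ≤ n → ∀ x t : ℝ,
      deriv (fun s => P n x s) t =
        (τ (n + 1) t / τ n t) *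
          ∑ i ∈ Finset.Icc 1 n, (-1 : ℝ) ^ (n - i) *
            (vCoef τ (i + 1) t - vCoef τ (i - 1) t) * (τ (i - 1) t / τ i t) *
              P (i - 1) x t) :
    ∀ n : ℕ, 2 ≤ n → ∀ x t : ℝ,
      x * (P n x t + uCoef τ n t * P (n - 1) x t) =
        P (n + 1) x t + (vCoef τ (n + 1) t - vCoef τ n t + uCoef τ n t) * P n x t -
          uCoef τ n t * (vCoef τ (n + 1) t - vCoef τ n t + uCoef τ (n + 1) t) *
            P (n - 1) x t -
          (uCoef τ n t) ^ 2 * uCoef τ (n - 1) t * P (n - 2) x t := by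
  intro n hn x t
  obtain ⟨m, rfl⟩ : ∃ m, n = m + 2 := ⟨n - 2, by omega⟩
  have hD := deriv_add_uCoef_mul_deriv τ P hτne H2 (m + 1) (by omega) x t
  have h₂ := H1 (m + 2) (by omega) x t
  have h₁ := H1 (m + 1) (by omega) x t
  simp only [Nat.add_sub_cancel, show m + 2 - 1 = m + 1 by omega,
    show m + 1 + 1 = m + 2 by omega] at *
  linear_combination h₂ + uCoef τ (m + 2) t * h₁ - hD
end
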